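/- In F₂[[q]], q·Δ(q)⁸ = D(q), where Δ(q) = ∑_{n≥0} q^{n(n+1)/2} is the generating function of the triangular numbers and D(q) = ∑_{n≥0} q^{(2n+1)²} is the generating function of the odd positive squares. -/

import Mathlib

open Classical

/-- `Δ(q) = ∑_{n ≥ 0} q^{n(n+1)/2}` over `F₂`, the generating function of triangular numbers. -/
noncomputable def DeltaSeries : PowerSeries (ZMod 2) :=
  PowerSeries.mk fun n => if ∃ k : ℕ, n = k * (k + 1) / 2 then 1 else 0

/-- `D(q) = ∑_{n ≥ 0} q^{(2n+1)²}` over `F₂`, the generating function of odd squares. -/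
noncomputable def DSeries : PowerSeries (ZMod 2) :=
  PowerSeries.mk fun n => if ∃ k : ℕ, n = (2 * k + 1) ^ 2 then 1 else 0

/-- Over `ZMod p`, raising a power series to the power `p ^ n` substitutes `X ^ p ^ n` for `X`. -/
theorem PowerSeries.expand_zmod_prime_pow (p : ℕ) [hp : Fact p.Prime] (n : ℕ)
    (f : PowerSeries (ZMod p)) :
    PowerSeries.expand (p ^ n) (pow_ne_zero n hp.out.ne_zero) f = f ^ p ^ n := by
  have h : iterateFrobenius (ZMod p) p n = RingHom.id (ZMod p) := Subsingleton.elim _ _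
  have key := MvPowerSeries.map_iterateFrobenius_expand p hp.out.ne_zero f n
  rw [h, MvPowerSeries.map_id] at key
  exact key

/-- Eight times a triangular number, plus one, is an odd square. -/
theorem odd_sq_eq_eight_mul_triangular_add_one (k : ℕ) :
    (2 * k + 1) ^ 2 = 8 * (k * (k + 1) / 2) + 1 := by
  have h := Nat.mul_div_cancel' (Nat.even_mul_succ_self k).two_dvd
  nlinarith

/-- In `F₂[[q]]`, `q · Δ(q)⁸ = D(q)`. -/
theorem X_mul_Delta_pow_eight :
    (PowerSeries.X : PowerSeries (ZMod 2)) * DeltaSeries ^ 8 = DSeries := by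
  have h : DeltaSeries ^ 8 = PowerSeries.expand 8 (by norm_num) DeltaSeries :=
    (PowerSeries.expand_zmod_prime_pow 2 3 DeltaSeries).symm
  ext n
  rw [h, DSeries, PowerSeries.coeff_mk]
  simp only [odd_sq_eq_eight_mul_triangular_add_one]
  cases n with
  | zero => simp
  | succ m =>
    rw [PowerSeries.coeff_succ_X_mul, PowerSeries.coeff_expand, DeltaSeries,
      PowerSeries.coeff_mk, ← ite_and]
    refine if_congr ⟨?_, ?_⟩ rfl rfl
    · rintro ⟨hm, k, hk⟩
      exact ⟨k, by omega⟩
    · rintro ⟨k, hk⟩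
      exact ⟨⟨k * (k + 1) / 2, by omega⟩, k, by omega⟩
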